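/- arXiv:math/0312065 — 2 statements merged into one kernel-verified Lean document; each statement's English description precedes it below -/
import Mathlib

section
/- Let K, T ⊂ ℝⁿ be compact symmetric convex bodies such that J_K(E) = J_T(E) for every ellipsoid E, where J_K(E) = inf{M_E(F) : F an ellipsoid, F ⊆ K} and M_E²(F) = ∫_{∂E} ‖x‖_F² dμ_E(x) with μ_E the invariant probability measure on ∂E. Then K = T. -/
open MeasureTheory Metric Set

noncomputable section
attribute [local instance] Classical.propDecidable

variable {n : ℕ}

/-- A (nondegenerate, centrally symmetric) ellipsoid in `ℝⁿ`: the image of the closed unit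
ball under an invertible linear map. -/
def IsEllipsoid {n : ℕ} (F : Set (EuclideanSpace ℝ (Fin n))) : Prop :=
  ∃ L : EuclideanSpace ℝ (Fin n) ≃ₗ[ℝ] EuclideanSpace ℝ (Fin n),
    F = L '' closedBall 0 1

/-- The uniform (rotation-invariant) probability measure on the unit sphere of `ℝⁿ`,
viewed as a measure on `ℝⁿ`. -/
def sphereProb (n : ℕ) : Measure (EuclideanSpace ℝ (Fin n)) :=
  letI σ : Measure (EuclideanSpace ℝ (Fin n)) :=
    ((volume : Measure (EuclideanSpace ℝ (Fin n))).toSphere).map Subtype.val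
  (σ Set.univ)⁻¹ • σ

/-- The invariant probability measure `μ_E` on the boundary of the ellipsoid
`E = L(closedBall 0 1)`: the pushforward of the uniform sphere measure by `L`.
(It does not depend on the choice of `L`.) -/
def ellMeasure {n : ℕ} (E : Set (EuclideanSpace ℝ (Fin n))) :
    Measure (EuclideanSpace ℝ (Fin n)) :=
  if h : IsEllipsoid E then (sphereProb n).map h.choose else 0

/-- `M_E(F) = (∫_{∂E} ‖x‖_F² dμ_E(x))^{1/2}`, where `‖·‖_F` is the Minkowski gauge of `F`. -/
def Mfun {n : ℕ} (E F : Set (EuclideanSpace ℝ (Fin n))) : ℝ :=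
  Real.sqrt (∫ x, (gauge F x) ^ 2 ∂(ellMeasure E))

/-- `J_K(E) = inf { M_E(F) : F an ellipsoid contained in K }`. -/
def Jfun {n : ℕ} (K E : Set (EuclideanSpace ℝ (Fin n))) : ℝ :=
  sInf { r | ∃ F, IsEllipsoid F ∧ F ⊆ K ∧ r = Mfun E F }


section
open scoped Pointwise

abbrev EE (n : ℕ) := EuclideanSpace ℝ (Fin n)

def sphMeas (n : ℕ) : Measure (EE n) :=
  ((volume : Measure (EE n)).toSphere).map Subtype.val

lemma sphMeas_apply {n : ℕ} {s : Set (EE n)} (hs : MeasurableSet s) :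
    sphMeas n s = Module.finrank ℝ (EE n) *
      (volume : Measure (EE n)) (Ioo (0 : ℝ) 1 • (s ∩ sphere (0 : EE n) 1)) := by
  rw [sphMeas, Measure.map_apply measurable_subtype_coe hs,
    Measure.toSphere_apply' _ (measurable_subtype_coe hs), Subtype.image_preimage_coe, inter_comm]

lemma sphMeas_map {n : ℕ} (U : EE n ≃ₗᵢ[ℝ] EE n) : (sphMeas n).map U = sphMeas n := by
  have hU : Measurable U := U.continuous.measurable
  ext s hs
  rw [Measure.map_apply hU hs, sphMeas_apply hs, sphMeas_apply (hU hs)]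
  congr 1
  have : Ioo (0 : ℝ) 1 • ((U ⁻¹' s) ∩ sphere (0 : EE n) 1)
      = U ⁻¹' (Ioo (0 : ℝ) 1 • (s ∩ sphere (0 : EE n) 1)) := by
    ext x
    simp only [mem_smul, mem_preimage, mem_inter_iff, mem_sphere_zero_iff_norm]
    constructor
    · rintro ⟨t, ht, y, ⟨hy, hy1⟩, rfl⟩
      exact ⟨t, ht, U y, ⟨hy, by simpa using hy1⟩, by simp⟩
    · rintro ⟨t, ht, y, ⟨hy, hy1⟩, hx⟩
      refine ⟨t, ht, U.symm y, ⟨by simpa using hy, by simpa using hy1⟩, ?_⟩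
      apply U.injective
      simp [← hx]
  rw [this]
  exact (U.measurePreserving).measure_preimage_equiv (f := U.toMeasurableEquiv) _

end

lemma sphereProb_eq (n : ℕ) : sphereProb n = (sphMeas n univ)⁻¹ • sphMeas n := rfl

lemma sphereProb_map {n : ℕ} (U : EE n ≃ₗᵢ[ℝ] EE n) :
    (sphereProb n).map U = sphereProb n := by
  rw [sphereProb_eq, Measure.map_smul, sphMeas_map]

lemma norm_le_of_ball {n : ℕ} {f : EE n →ₗ[ℝ] EE n}
    (hf : ∀ x, ‖x‖ ≤ 1 → ‖f x‖ ≤ 1) (x : EE n) : ‖f x‖ ≤ ‖x‖ := by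
  rcases eq_or_ne x 0 with rfl | hx
  · simp
  have h0 : 0 < ‖x‖ := norm_pos_iff.2 hx
  have := hf ((‖x‖)⁻¹ • x) (by rw [norm_smul, norm_inv, norm_norm, inv_mul_cancel₀ h0.ne'])
  rw [map_smul, norm_smul, norm_inv, norm_norm, inv_mul_le_iff₀ h0, mul_one] at this
  exact this

lemma exists_isom {n : ℕ} (L L' : EE n ≃ₗ[ℝ] EE n)
    (h : L '' closedBall 0 1 = L' '' closedBall 0 1) :
    ∃ U : EE n ≃ₗᵢ[ℝ] EE n, ∀ x, L' x = L (U x) := by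
  have key : ∀ A B : EE n ≃ₗ[ℝ] EE n, A '' closedBall 0 1 = B '' closedBall 0 1 →
      ∀ x, ‖A.symm (B x)‖ ≤ ‖x‖ := by
    intro A B hAB x
    refine norm_le_of_ball (f := (B.trans A.symm).toLinearMap) ?_ x
    intro y hy
    have : B y ∈ A '' closedBall 0 1 := by
      rw [hAB]; exact ⟨y, by simpa using hy, rfl⟩
    obtain ⟨z, hz, hzy⟩ := this
    have : A.symm (B y) = z := by rw [← hzy]; simp
    simpa [this] using hz
  refine ⟨⟨L'.trans L.symm, fun x => le_antisymm (key L L' h x) ?_⟩, fun x => ?_⟩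
  · simpa using key L' L h.symm (L.symm (L' x))
  · change L' x = L (L.symm (L' x))
    simp

lemma measEmb {n : ℕ} (L : EE n ≃ₗ[ℝ] EE n) : MeasurableEmbedding L :=
  L.toContinuousLinearEquiv.toHomeomorph.measurableEmbedding

lemma ellMeasure_eq {n : ℕ} (L : EE n ≃ₗ[ℝ] EE n) :
    ellMeasure (L '' closedBall 0 1) = (sphereProb n).map L := by
  have h : IsEllipsoid (L '' closedBall 0 1) := ⟨L, rfl⟩
  rw [ellMeasure, dif_pos h]
  obtain ⟨U, hU⟩ := exists_isom L h.choose h.choose_spec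
  have : (h.choose : EE n → EE n) = L ∘ U := funext hU
  rw [this, ← Measure.map_map (measEmb L).measurable U.continuous.measurable, sphereProb_map]

def kk (n : ℕ) : ℝ := ((sphMeas n univ)⁻¹).toReal

/-- the un-normalised integral -/
def II {n : ℕ} (F : Set (EE n)) (f : EE n → EE n) : ℝ :=
  ∫ u : sphere (0 : EE n) 1, (gauge F (f u)) ^ 2 ∂(volume : Measure (EE n)).toSphere

lemma Mfun_eq {n : ℕ} (L : EE n ≃ₗ[ℝ] EE n) (F : Set (EE n)) :
    Mfun (L '' closedBall 0 1) F = Real.sqrt (kk n * II F L) := by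
  rw [Mfun, ellMeasure_eq, (measEmb L).integral_map, sphereProb_eq, integral_smul_measure, sphMeas,
    (MeasurableEmbedding.subtype_coe isClosed_sphere.measurableSet).integral_map]
  rfl

lemma kk_pos {n : ℕ} [Nontrivial (EE n)] : 0 < kk n := by
  have h1 : sphMeas n univ = (volume : Measure (EE n)).toSphere univ := by
    rw [sphMeas, Measure.map_apply measurable_subtype_coe MeasurableSet.univ, preimage_univ]
  rw [kk, h1]
  apply ENNReal.toReal_pos
  · exact ENNReal.inv_ne_zero.2 (measure_ne_top _ _)
  · exact ENNReal.inv_ne_top.2 (by simp [-Measure.toSphere_apply_univ])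

/-- `u ↦ ⟪x,u⟫ x + b u` -/
def Sb {n : ℕ} (x : EE n) (a b : ℝ) : EE n →ₗ[ℝ] EE n :=
  a • ((innerSL ℝ x).toLinearMap.smulRight x) + b • LinearMap.id

lemma Sb_apply {n : ℕ} (x : EE n) (a b : ℝ) (u : EE n) :
    Sb x a b u = (a * inner ℝ x u) • x + b • u := by
  simp [Sb, smul_smul]

lemma Sb_inj {n : ℕ} (x : EE n) {a b : ℝ} (ha : 0 ≤ a) (hb : 0 < b) :
    Function.Injective (Sb x a b) := by
  rw [injective_iff_map_eq_zero]
  intro u hu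
  rw [Sb_apply] at hu
  have h1 : inner ℝ ((a * inner ℝ x u) • x + b • u) u = 0 := by rw [hu]; simp
  rw [inner_add_left, real_inner_smul_left, real_inner_smul_left, real_inner_self_eq_norm_sq] at h1
  have h2 : 0 ≤ a * (inner ℝ x u * inner ℝ x u) := mul_nonneg ha (mul_self_nonneg _)
  have h3 : b * ‖u‖ ^ 2 ≤ 0 := by nlinarith
  have h4 : ‖u‖ ^ 2 ≤ 0 := by
    by_contra hc
    push Not at hc
    have := mul_pos hb hc
    linarith
  have : ‖u‖ = 0 := by nlinarith [norm_nonneg u]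
  exact norm_eq_zero.1 this

lemma exists_Sb {n : ℕ} (x : EE n) {a b : ℝ} (ha : 0 ≤ a) (hb : 0 < b) :
    ∃ L : EE n ≃ₗ[ℝ] EE n, ∀ u, L u = (a * inner ℝ x u) • x + b • u :=
  ⟨LinearEquiv.ofInjectiveEndo _ (Sb_inj x ha hb), fun u => by
    rw [LinearEquiv.coe_ofInjectiveEndo, Sb_apply]⟩

lemma ell_convex {n : ℕ} {F : Set (EE n)} (h : IsEllipsoid F) : Convex ℝ F := by
  obtain ⟨L, rfl⟩ := h
  exact (convex_closedBall 0 1).linear_image L.toLinearMap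

lemma ell_nhds {n : ℕ} {F : Set (EE n)} (h : IsEllipsoid F) : F ∈ nhds (0 : EE n) := by
  obtain ⟨L, rfl⟩ := h
  have := L.toContinuousLinearEquiv.toHomeomorph.isOpenMap.image_mem_nhds
    (closedBall_mem_nhds (0 : EE n) one_pos)
  simpa using this

lemma II_tendsto {n : ℕ} {F : Set (EE n)} (hc : Convex ℝ F) (h0 : F ∈ nhds (0 : EE n)) (x : EE n) :
    Continuous (fun b : ℝ => II F (fun u => ((1:ℝ) * inner ℝ x u) • x + b • u)) := by
  have hg := continuous_gauge hc h0
  have := continuous_parametric_integral_of_continuous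
    (μ := (volume : Measure (EE n)).toSphere)
    (f := fun (b : ℝ) (u : sphere (0 : EE n) 1) =>
      (gauge F (((1:ℝ) * inner ℝ x (u : EE n)) • x + b • (u : EE n))) ^ 2)
    (by unfold Function.uncurry; fun_prop) isCompact_univ
  simpa [II] using this

lemma II_int {n : ℕ} {F : Set (EE n)} (hc : Convex ℝ F) (h0 : F ∈ nhds (0 : EE n))
    {f : EE n → EE n} (hf : Continuous f) :
    Integrable (fun u : sphere (0 : EE n) 1 => (gauge F (f u)) ^ 2)
      (volume : Measure (EE n)).toSphere := by
  have hg := continuous_gauge hc h0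
  apply Continuous.integrable_of_hasCompactSupport (by fun_prop)
  exact HasCompactSupport.of_compactSpace _

lemma II_mono {n : ℕ} {F T : Set (EE n)} (hF : IsEllipsoid F) (hc : Convex ℝ T) (hFT : F ⊆ T)
    {f : EE n → EE n} (hf : Continuous f) : II T f ≤ II F f := by
  have h0 := ell_nhds hF
  refine integral_mono (II_int hc (Filter.mem_of_superset h0 hFT) hf)
    (II_int (ell_convex hF) h0 hf) ?_
  intro u
  have := gauge_mono (absorbent_nhds_zero h0) hFT (f u)
  have h2 := gauge_nonneg (s := T) (f u)
  dsimp only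
  gcongr

def cc {n : ℕ} (x : EE n) : ℝ :=
  ∫ u : sphere (0 : EE n) 1, (inner ℝ x (u : EE n)) ^ 2 ∂(volume : Measure (EE n)).toSphere

lemma cc_pos {n : ℕ} {x : EE n} (hx : x ≠ 0) : 0 < cc x := by
  have hn : 0 < ‖x‖ := norm_pos_iff.2 hx
  refine Continuous.integral_pos_of_hasCompactSupport_nonneg_nonzero
    (x := ⟨(‖x‖)⁻¹ • x, ?_⟩) (by fun_prop) (HasCompactSupport.of_compactSpace _)
    (fun u => sq_nonneg _) ?_
  · rw [mem_sphere_zero_iff_norm, norm_smul, norm_inv, norm_norm, inv_mul_cancel₀ hn.ne']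
  · rw [real_inner_smul_right, real_inner_self_eq_norm_sq]
    positivity

lemma II_zero {n : ℕ} {F : Set (EE n)} (hs : ∀ y ∈ F, -y ∈ F) (x : EE n) :
    II F (fun u => ((1:ℝ) * inner ℝ x u) • x + (0 : ℝ) • u) = cc x * gauge F x ^ 2 := by
  rw [II, cc, ← integral_mul_const]
  congr 1
  ext u
  rw [zero_smul, add_zero, one_mul]
  rcases le_total 0 (inner ℝ x (u : EE n)) with hi | hi
  · rw [gauge_smul_of_nonneg hi, smul_eq_mul, mul_pow]
  · rw [← gauge_neg hs, ← neg_smul, gauge_smul_of_nonneg (neg_nonneg.2 hi), smul_eq_mul, mul_pow,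
      neg_sq]

lemma ell_symm {n : ℕ} {F : Set (EE n)} (h : IsEllipsoid F) : ∀ y ∈ F, -y ∈ F := by
  obtain ⟨L, rfl⟩ := h
  rintro _ ⟨z, hz, rfl⟩
  exact ⟨-z, by simpa using hz, by simp⟩

lemma exists_ell {n : ℕ} {K : Set (EE n)} (hc : Convex ℝ K) (hs : ∀ y ∈ K, -y ∈ K)
    (h0 : K ∈ nhds (0 : EE n)) {x : EE n} (hx : x ≠ 0) (hxK : x ∈ K) {g : ℝ} (hg : 1 < g) :
    ∃ F, IsEllipsoid F ∧ F ⊆ K ∧ gauge F x < g := by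
  have hn : 0 < ‖x‖ := norm_pos_iff.2 hx
  obtain ⟨r, hr, hrK⟩ := Metric.nhds_basis_closedBall.mem_iff.1 h0
  obtain ⟨t, ht1, ht2⟩ := exists_between (inv_lt_one_of_one_lt₀ hg)
  have ht0 : 0 < t := lt_trans (by positivity) ht1
  obtain ⟨L, hL⟩ := exists_Sb x (a := t / ‖x‖) (b := (1 - t) * r) (by positivity)
    (mul_pos (by linarith) hr)
  refine ⟨L '' closedBall 0 1, ⟨L, rfl⟩, ?_, ?_⟩
  · rintro _ ⟨u, hu, rfl⟩
    have hu1 : ‖u‖ ≤ 1 := by simpa using hu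
    rw [hL]
    have e : ((t / ‖x‖) * inner ℝ x u) • x + ((1 - t) * r) • u
        = t • ((inner ℝ x u / ‖x‖) • x) + (1 - t) • (r • u) := by
      rw [smul_smul, smul_smul]; congr 2; ring
    rw [e]
    refine hc ?_ ?_ ht0.le (by linarith) (by ring)
    · have hi : |inner ℝ x u / ‖x‖| ≤ 1 := by
        rw [abs_div, abs_norm, div_le_one hn]
        calc _ ≤ ‖x‖ * ‖u‖ := abs_real_inner_le_norm x u
          _ ≤ ‖x‖ * 1 := by gcongr
          _ = _ := mul_one _
      have hbal : Balanced ℝ K := by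
        rw [balanced_iff_neg_mem hc]
        intro y hy
        exact hs y hy
      exact hbal.smul_mem (by rw [Real.norm_eq_abs]; exact hi) hxK
    · apply hrK
      rw [mem_closedBall_zero_iff, norm_smul, Real.norm_eq_abs, abs_of_pos hr]
      nlinarith
  · set s := t + (1 - t) * r / ‖x‖ with hsdef
    have hst : t ≤ s := by
      have : 0 ≤ (1 - t) * r / ‖x‖ := by
        have : 0 ≤ 1 - t := by linarith
        positivity
      linarith
    have hs0 : 0 < s := by linarith
    have hmem : s • x ∈ L '' closedBall 0 1 := by
      refine ⟨(‖x‖)⁻¹ • x, ?_, ?_⟩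
      · rw [mem_closedBall_zero_iff, norm_smul, norm_inv, norm_norm, inv_mul_cancel₀ hn.ne']
      · rw [hL, real_inner_smul_right, real_inner_self_eq_norm_sq, smul_smul, ← add_smul]
        congr 1
        rw [hsdef]; field_simp
    have h1 : gauge (L '' closedBall 0 1) x ≤ s⁻¹ := by
      apply gauge_le_of_mem (by positivity)
      exact ⟨s • x, hmem, by simp [smul_smul, inv_mul_cancel₀ hs0.ne']⟩
    calc _ ≤ s⁻¹ := h1
      _ ≤ t⁻¹ := by gcongr
      _ < g := by
        rw [inv_lt_comm₀ ht0 (by linarith)]; exact ht1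

lemma subset_of_J_eq {n : ℕ} {K T : Set (EE n)}
    (hKconv : Convex ℝ K) (hKsymm : ∀ y ∈ K, -y ∈ K) (hK0 : K ∈ nhds (0 : EE n))
    (hTconv : Convex ℝ T) (hTcl : IsClosed T) (hTsymm : ∀ y ∈ T, -y ∈ T)
    (hT0 : T ∈ nhds (0 : EE n))
    (h : ∀ E : Set (EE n), IsEllipsoid E → Jfun K E = Jfun T E) : K ⊆ T := by
  intro x hxK
  by_contra hxT
  have hx : x ≠ 0 := by
    rintro rfl
    exact hxT (mem_of_mem_nhds hT0)
  have : Nontrivial (EE n) := ⟨x, 0, hx⟩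
  have hg : 1 < gauge T x := by
    by_contra hc
    push Not at hc
    rw [gauge_le_one_iff_mem_closure hTconv hT0, hTcl.closure_eq] at hc
    exact hxT hc
  obtain ⟨F, hF, hFK, hFg⟩ := exists_ell hKconv hKsymm hK0 hx hxK hg
  have key : ∀ b : ℝ, 0 < b → II T (fun u => ((1:ℝ) * inner ℝ x u) • x + b • u) ≤
      II F (fun u => ((1:ℝ) * inner ℝ x u) • x + b • u) := by
    intro b hb
    obtain ⟨L, hL⟩ := exists_Sb x (a := 1) (b := b) zero_le_one hb
    have hLf : (L : EE n → EE n) = (fun u => ((1:ℝ) * inner ℝ x u) • x + b • u) := funext hL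
    have hE : IsEllipsoid (L '' closedBall 0 1) := ⟨L, rfl⟩
    have h1 : Jfun K (L '' closedBall 0 1) ≤ Mfun (L '' closedBall 0 1) F := by
      apply csInf_le
      · refine ⟨0, ?_⟩
        rintro _ ⟨_, _, _, rfl⟩
        exact Real.sqrt_nonneg _
      · exact ⟨F, hF, hFK, rfl⟩
    have h2 : Real.sqrt (kk n * II T L) ≤ Jfun T (L '' closedBall 0 1) := by
      apply le_csInf
      · obtain ⟨r, hr, hrT⟩ := Metric.nhds_basis_closedBall.mem_iff.1 hT0
        obtain ⟨A, hA⟩ := exists_Sb (0 : EE n) (a := 0) (b := r) le_rfl hr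
        refine ⟨_, A '' closedBall 0 1, ⟨A, rfl⟩, ?_, rfl⟩
        rintro _ ⟨u, hu, rfl⟩
        apply hrT
        have hu1 : ‖u‖ ≤ 1 := by simpa using hu
        rw [hA, mem_closedBall_zero_iff]
        simp only [zero_mul, zero_smul, zero_add, norm_smul, Real.norm_eq_abs, abs_of_pos hr]
        nlinarith
      · rintro _ ⟨G, hG, hGT, rfl⟩
        rw [Mfun_eq]
        apply Real.sqrt_le_sqrt
        exact mul_le_mul_of_nonneg_left
          (II_mono hG hTconv hGT L.toContinuousLinearEquiv.continuous) kk_pos.le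
    have h3 := h2.trans ((h _ hE).symm.le.trans h1)
    rw [Mfun_eq] at h3
    have hnn : 0 ≤ II F L := integral_nonneg fun u => sq_nonneg _
    rw [Real.sqrt_le_sqrt_iff (mul_nonneg kk_pos.le hnn)] at h3
    have h4 := le_of_mul_le_mul_left h3 kk_pos
    rwa [hLf] at h4
  have hlim : II T (fun u => ((1:ℝ) * inner ℝ x u) • x + (0:ℝ) • u) ≤
      II F (fun u => ((1:ℝ) * inner ℝ x u) • x + (0:ℝ) • u) := by
    have t1 := ((II_tendsto hTconv hT0 x).tendsto 0).mono_left
      (nhdsWithin_le_nhds (s := Ioi (0:ℝ)))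
    have t2 := ((II_tendsto (ell_convex hF) (ell_nhds hF) x).tendsto 0).mono_left
      (nhdsWithin_le_nhds (s := Ioi (0:ℝ)))
    refine le_of_tendsto_of_tendsto t1 t2 ?_
    filter_upwards [self_mem_nhdsWithin] with b hb using key b hb
  rw [II_zero hTsymm, II_zero (ell_symm hF)] at hlim
  have h5 := le_of_mul_le_mul_left hlim (cc_pos hx)
  have h6 := gauge_nonneg (s := F) x
  nlinarith

/-- If `K, T ⊂ ℝⁿ` are compact symmetric convex bodies with `J_K(E) = J_T(E)` for every
ellipsoid `E`, then `K = T`. -/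
theorem eq_of_J_eq
    (n : ℕ) (K T : Set (EuclideanSpace ℝ (Fin n)))
    (hKconv : Convex ℝ K) (hKcomp : IsCompact K) (hKsymm : K = -K)
    (hKint : (0 : EuclideanSpace ℝ (Fin n)) ∈ interior K)
    (hTconv : Convex ℝ T) (hTcomp : IsCompact T) (hTsymm : T = -T)
    (hTint : (0 : EuclideanSpace ℝ (Fin n)) ∈ interior T)
    (h : ∀ E : Set (EuclideanSpace ℝ (Fin n)), IsEllipsoid E → Jfun K E = Jfun T E) :
    K = T := by
  have sK : ∀ y ∈ K, -y ∈ K := fun y hy => by rw [hKsymm] at hy; simpa using hy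
  have sT : ∀ y ∈ T, -y ∈ T := fun y hy => by rw [hTsymm] at hy; simpa using hy
  have nK := mem_interior_iff_mem_nhds.1 hKint
  have nT := mem_interior_iff_mem_nhds.1 hTint
  exact Subset.antisymm
    (subset_of_J_eq hKconv sK nK hTconv hTcomp.isClosed sT nT h)
    (subset_of_J_eq hTconv sT nT hKconv hKcomp.isClosed sK nK fun E hE => (h E hE).symm)

end
end

section
/- Let K ⊂ ℝⁿ be a compact symmetric convex body and for each ellipsoid E let u_K(E) denote the unique ellipsoid F ⊆ K minimizing M_E(F). If K, T are two such bodies with u_K = u_T (as maps on ellipsoids), then K = T. -/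
open MeasureTheory Metric Set

noncomputable section
attribute [local instance] Classical.propDecidable

variable {n : ℕ}

section Helpers

open scoped Pointwise

lemma gauge_image_equiv {n : ℕ} (L : EuclideanSpace ℝ (Fin n) ≃ₗ[ℝ] EuclideanSpace ℝ (Fin n))
    (y : EuclideanSpace ℝ (Fin n)) :
    gauge (L '' closedBall 0 1) y = ‖L.symm y‖ := by
  have h1 : gauge (closedBall (0 : EuclideanSpace ℝ (Fin n)) 1) (L.symm y) = ‖L.symm y‖ := by
    rw [gauge_closedBall zero_le_one, div_one]
  rw [← h1, gauge_def, gauge_def]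
  congr 1
  ext r
  simp only [Set.mem_ofPred_eq, and_congr_right_iff]
  intro _
  constructor
  · rintro ⟨_, ⟨v, hv, rfl⟩, hy⟩
    refine ⟨v, hv, ?_⟩
    simp only at hy ⊢
    rw [← hy]
    simp
  · rintro ⟨v, hv, hy⟩
    refine ⟨L v, ⟨v, hv, rfl⟩, ?_⟩
    simp only at hy ⊢
    rw [← map_smul, hy]
    simp

lemma smul_sphere_preimage {n : ℕ}
    (Q : EuclideanSpace ℝ (Fin n) ≃ₗᵢ[ℝ] EuclideanSpace ℝ (Fin n))
    (s : Set (EuclideanSpace ℝ (Fin n))) :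
    Ioo (0 : ℝ) 1 • ((Q ⁻¹' s) ∩ sphere 0 1) = Q ⁻¹' (Ioo (0 : ℝ) 1 • (s ∩ sphere 0 1)) := by
  ext y
  simp only [Set.mem_smul, Set.mem_preimage, Set.mem_inter_iff]
  constructor
  · rintro ⟨r, hr, v, ⟨hv, hv1⟩, rfl⟩
    refine ⟨r, hr, Q v, ⟨hv, ?_⟩, by simp⟩
    simpa using hv1
  · rintro ⟨r, hr, v, ⟨hv, hv1⟩, hy⟩
    refine ⟨r, hr, Q.symm v, ⟨by simpa using hv, by simpa using hv1⟩, ?_⟩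
    rw [← map_smul, hy]
    simp

lemma sphere_map_apply {n : ℕ} {s : Set (EuclideanSpace ℝ (Fin n))} (hs : MeasurableSet s) :
    (((volume : Measure (EuclideanSpace ℝ (Fin n))).toSphere).map Subtype.val) s
      = (Module.finrank ℝ (EuclideanSpace ℝ (Fin n))) *
        volume (Ioo (0 : ℝ) 1 • (s ∩ sphere 0 1)) := by
  rw [Measure.map_apply measurable_subtype_coe hs,
    Measure.toSphere_apply' _ (measurable_subtype_coe hs)]
  congr 3
  rw [Set.image_preimage_eq_inter_range, Subtype.range_coe]

lemma sphereProb_map_isometry {n : ℕ}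
    (Q : EuclideanSpace ℝ (Fin n) ≃ₗᵢ[ℝ] EuclideanSpace ℝ (Fin n)) :
    (sphereProb n).map Q = sphereProb n := by
  have hQ : Measurable Q := Q.continuous.measurable
  unfold sphereProb
  rw [Measure.map_smul]
  congr 1
  ext s hs
  rw [Measure.map_apply hQ hs, sphere_map_apply hs, sphere_map_apply (hQ hs),
    smul_sphere_preimage, Q.measurePreserving.measure_preimage_emb
      Q.toHomeomorph.measurableEmbedding]

lemma isEllipsoid_image {n : ℕ}
    (L : EuclideanSpace ℝ (Fin n) ≃ₗ[ℝ] EuclideanSpace ℝ (Fin n)) :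
    IsEllipsoid (L '' closedBall 0 1) := ⟨L, rfl⟩

lemma measurable_equiv {n : ℕ}
    (L : EuclideanSpace ℝ (Fin n) ≃ₗ[ℝ] EuclideanSpace ℝ (Fin n)) : Measurable L :=
  (L.toLinearMap.continuous_of_finiteDimensional).measurable

lemma continuous_equiv {n : ℕ}
    (L : EuclideanSpace ℝ (Fin n) ≃ₗ[ℝ] EuclideanSpace ℝ (Fin n)) : Continuous L :=
  (L.toLinearMap.continuous_of_finiteDimensional)

lemma ellMeasure_image {n : ℕ}
    (L : EuclideanSpace ℝ (Fin n) ≃ₗ[ℝ] EuclideanSpace ℝ (Fin n)) :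
    ellMeasure (L '' closedBall 0 1) = (sphereProb n).map L := by
  have h := isEllipsoid_image L
  unfold ellMeasure
  rw [dif_pos h]
  have hc := h.choose_spec
  set L' := h.choose
  have hn : ∀ y, ‖L.symm y‖ = ‖L'.symm y‖ := fun y => by
    rw [← gauge_image_equiv, ← gauge_image_equiv, ← hc]
  let Q : EuclideanSpace ℝ (Fin n) ≃ₗᵢ[ℝ] EuclideanSpace ℝ (Fin n) :=
    { toLinearEquiv := L'.trans L.symm
      norm_map' := fun v => by
        simp only [LinearEquiv.trans_apply]
        rw [hn]; simp }
  have hcomp : (L' : EuclideanSpace ℝ (Fin n) → EuclideanSpace ℝ (Fin n)) = L ∘ Q := by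
    ext1 v
    show L' v = L (L.symm (L' v))
    simp
  rw [hcomp, ← Measure.map_map (measurable_equiv L) Q.continuous.measurable,
    sphereProb_map_isometry]

lemma sphereProb_isProb {n : ℕ} (hn : 0 < n) : IsProbabilityMeasure (sphereProb n) := by
  have : Nonempty (Fin n) := ⟨⟨0, hn⟩⟩
  constructor
  unfold sphereProb
  simp only [Measure.smul_apply, smul_eq_mul]
  rw [Measure.map_apply measurable_subtype_coe MeasurableSet.univ, Set.preimage_univ]
  refine ENNReal.inv_mul_cancel ?_ (measure_ne_top _ _)
  rw [Ne, Measure.measure_univ_eq_zero]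
  exact Measure.toSphere_ne_zero _

lemma sphereProb_ae {n : ℕ} : ∀ᵐ x ∂(sphereProb n), ‖x‖ = 1 := by
  unfold sphereProb
  refine Measure.ae_smul_measure ?_ _
  rw [ae_map_iff measurable_subtype_coe.aemeasurable
    (measurableSet_eq_fun measurable_norm measurable_const)]
  exact Filter.Eventually.of_forall fun x => by simpa using x.2

lemma sphereProb_integrable {n : ℕ} (hn : 0 < n) {g : EuclideanSpace ℝ (Fin n) → ℝ}
    (hg : Continuous g) : Integrable g (sphereProb n) := by
  have := sphereProb_isProb hn
  obtain ⟨C, hC⟩ := (isCompact_sphere (0 : EuclideanSpace ℝ (Fin n)) 1).exists_bound_of_continuousOn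
    hg.continuousOn
  refine Integrable.of_bound hg.aestronglyMeasurable C ?_
  filter_upwards [sphereProb_ae] with x hx
  exact hC x (by simpa using hx)

lemma Mfun_image {n : ℕ}
    (L G : EuclideanSpace ℝ (Fin n) ≃ₗ[ℝ] EuclideanSpace ℝ (Fin n)) :
    Mfun (L '' closedBall 0 1) (G '' closedBall 0 1)
      = Real.sqrt (∫ θ, ‖G.symm (L θ)‖ ^ 2 ∂(sphereProb n)) := by
  unfold Mfun
  rw [ellMeasure_image]
  simp only [gauge_image_equiv]
  rw [integral_map (measurable_equiv L).aemeasurable]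
  exact ((continuous_equiv G.symm).norm.pow 2).aestronglyMeasurable

/-- second moment in a direction -/
lemma moment_pos {n : ℕ} (hn : 0 < n) (e : EuclideanSpace ℝ (Fin n)) (he : ‖e‖ = 1) :
    0 < ∫ θ, (inner ℝ e θ) ^ 2 ∂(sphereProb n) := by
  have := sphereProb_isProb hn
  have hint : ∀ v : EuclideanSpace ℝ (Fin n),
      Integrable (fun θ => (inner ℝ v θ) ^ 2) (sphereProb n) := fun v =>
    sphereProb_integrable hn (by fun_prop)
  have hinv : ∀ v : EuclideanSpace ℝ (Fin n), ‖v‖ = 1 →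
      ∫ θ, (inner ℝ v θ) ^ 2 ∂(sphereProb n) = ∫ θ, (inner ℝ e θ) ^ 2 ∂(sphereProb n) := by
    intro v hv
    let Q := Submodule.reflection (ℝ ∙ (v - e))ᗮ
    have hQ : Q v = e := Submodule.reflection_sub (by rw [hv, he])
    conv_rhs => rw [← sphereProb_map_isometry Q]
    rw [integral_map Q.continuous.measurable.aemeasurable
      (Continuous.aestronglyMeasurable (by fun_prop))]
    refine integral_congr_ae (Filter.Eventually.of_forall fun θ => ?_)
    simp only
    rw [← hQ, LinearIsometryEquiv.inner_map_map]
  have hsum : ∑ i : Fin n, ∫ θ, (inner ℝ (EuclideanSpace.basisFun (Fin n) ℝ i) θ) ^ 2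
      ∂(sphereProb n) = 1 := by
    rw [← integral_finsetSum _ (fun i _ => hint _)]
    have : ∫ θ, (1 : ℝ) ∂(sphereProb n) = 1 := by simp
    rw [← this]
    refine integral_congr_ae ?_
    filter_upwards [sphereProb_ae] with θ hθ
    have := (EuclideanSpace.basisFun (Fin n) ℝ).sum_sq_norm_inner_right θ
    rw [hθ] at this
    simpa using this
  rw [Finset.sum_congr rfl (fun i _ => hinv _ (OrthonormalBasis.norm_eq_one _ i))] at hsum
  simp only [Finset.sum_const, Finset.card_univ, Fintype.card_fin, nsmul_eq_mul] at hsum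
  have hn' : (0 : ℝ) < n := by exact_mod_cast hn
  by_contra hcon
  push Not at hcon
  nlinarith

/-- scaling by `s` along `e` and by `t` orthogonally to `e` -/
def dMap {n : ℕ} (e : EuclideanSpace ℝ (Fin n)) (s t : ℝ) :
    EuclideanSpace ℝ (Fin n) →ₗ[ℝ] EuclideanSpace ℝ (Fin n) :=
  t • LinearMap.id + (s - t) • ((innerₛₗ ℝ e).smulRight e)

lemma dMap_apply {n : ℕ} (e : EuclideanSpace ℝ (Fin n)) (s t : ℝ)
    (v : EuclideanSpace ℝ (Fin n)) :
    dMap e s t v = (s * inner ℝ e v) • e + t • (v - (inner ℝ e v : ℝ) • e) := by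
  simp [dMap]
  module

lemma dMap_comp {n : ℕ} {e : EuclideanSpace ℝ (Fin n)} (he : ‖e‖ = 1) (s t s' t' : ℝ)
    (v : EuclideanSpace ℝ (Fin n)) :
    dMap e s t (dMap e s' t' v) = dMap e (s * s') (t * t') v := by
  have : inner ℝ e (dMap e s' t' v) = s' * inner ℝ e v := by
    simp [dMap_apply, inner_add_right, inner_smul_right, inner_sub_right,
      real_inner_self_eq_norm_sq, he]
  rw [dMap_apply e s t, this, dMap_apply, dMap_apply]
  module

lemma dMap_one {n : ℕ} (e : EuclideanSpace ℝ (Fin n)) (v : EuclideanSpace ℝ (Fin n)) :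
    dMap e 1 1 v = v := by
  rw [dMap_apply]; module

def dEquiv {n : ℕ} (e : EuclideanSpace ℝ (Fin n)) (he : ‖e‖ = 1) (s t : ℝ) (hs : s ≠ 0)
    (ht : t ≠ 0) : EuclideanSpace ℝ (Fin n) ≃ₗ[ℝ] EuclideanSpace ℝ (Fin n) :=
  LinearEquiv.ofLinearMap (dMap e s t) (dMap e s⁻¹ t⁻¹)
    (by ext1 v; simp [dMap_comp he, hs, ht, dMap_one])
    (by ext1 v; simp [dMap_comp he, hs, ht, dMap_one])

lemma norm_perp_sq {n : ℕ} {e : EuclideanSpace ℝ (Fin n)} (he : ‖e‖ = 1)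
    (v : EuclideanSpace ℝ (Fin n)) (a b : ℝ) :
    ‖(a * inner ℝ e v) • e + b • (v - (inner ℝ e v : ℝ) • e)‖ ^ 2
      = a ^ 2 * (inner ℝ e v) ^ 2 + b ^ 2 * (‖v‖ ^ 2 - (inner ℝ e v) ^ 2) := by
  have h1 : inner ℝ v e = inner ℝ e v := real_inner_comm _ _
  rw [← real_inner_self_eq_norm_sq, ← real_inner_self_eq_norm_sq v]
  simp only [inner_add_left, inner_add_right, inner_smul_left, inner_smul_right, inner_sub_left,
    inner_sub_right, real_inner_self_eq_norm_sq e, he, h1]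
  simp
  ring

lemma norm_perp_le {n : ℕ} {e : EuclideanSpace ℝ (Fin n)} (he : ‖e‖ = 1)
    (v : EuclideanSpace ℝ (Fin n)) :
    ‖v - (inner ℝ e v : ℝ) • e‖ ≤ ‖v‖ := by
  have h := norm_perp_sq he v 0 1
  simp at h
  refine le_of_sq_le_sq ?_ (norm_nonneg _)
  nlinarith [sq_nonneg (inner ℝ e v : ℝ)]

lemma final_ineq {a q p ε N : ℝ} (hε : 0 ≤ ε) (hp : 0 ≤ p) (ha : |a| ≤ 1) (hq : |q| ≤ N) :
    p ^ 2 * a ^ 2 - 2 * ε * p * N ≤ (p * a + ε * q) ^ 2 := by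
  have h8 : |a * q| ≤ N := by
    rw [abs_mul]
    calc |a| * |q| ≤ 1 * |q| := by gcongr
      _ ≤ N := by linarith
  have h9 := (abs_le.1 h8).1
  have h10 : 0 ≤ ε * p := by positivity
  have h11 := mul_nonneg h10 (by linarith : 0 ≤ a * q + N)
  have h12 := sq_nonneg (ε * q)
  have : (p * a + ε * q) ^ 2 - (p ^ 2 * a ^ 2 - 2 * ε * p * N)
      = 2 * (ε * p * (a * q + N)) + (ε * q) ^ 2 := by ring
  linarith

set_option maxHeartbeats 1000000 in
lemma key_subset {n : ℕ} (K T : Set (EuclideanSpace ℝ (Fin n)))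
    (hKconv : Convex ℝ K) (hKsymm : K = -K)
    (hKint : (0 : EuclideanSpace ℝ (Fin n)) ∈ interior K)
    (hTconv : Convex ℝ T) (hTclosed : IsClosed T) (hTsymm : T = -T)
    (hT0 : (0 : EuclideanSpace ℝ (Fin n)) ∈ T)
    (hu : ∀ E, IsEllipsoid E → ∃ U, IsEllipsoid U ∧ U ⊆ T ∧
      ∀ F, IsEllipsoid F → F ⊆ K → Mfun E U ≤ Mfun E F) : K ⊆ T := by
  intro z hzK
  by_contra hzT
  have hz0 : z ≠ 0 := fun h => hzT (h ▸ hT0)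
  have hn : 0 < n := by
    rcases Nat.eq_zero_or_pos n with h | h
    · subst h
      exact absurd (Subsingleton.elim z 0) hz0
    · exact h
  have := sphereProb_isProb hn
  -- the separating functional
  obtain ⟨f₀, u, hfT, hfz⟩ := geometric_hahn_banach_closed_point hTconv hTclosed hzT
  have hu0 : 0 < u := by simpa using hfT 0 hT0
  obtain ⟨f, hfT1, hfz1⟩ : ∃ f : StrongDual ℝ (EuclideanSpace ℝ (Fin n)),
      (∀ t ∈ T, |f t| ≤ 1) ∧ 1 < f z := by
    refine ⟨u⁻¹ • f₀, fun t ht => ?_, ?_⟩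
    · have h1 := hfT t ht
      have h2 := hfT (-t) (by rw [hTsymm]; simpa using ht)
      rw [map_neg] at h2
      have h3 : |f₀ t| ≤ u := abs_le.2 ⟨by linarith, h1.le⟩
      simp only [_root_.smul_apply, smul_eq_mul, abs_mul, abs_inv, abs_of_pos hu0]
      rw [inv_mul_le_iff₀ hu0]; linarith
    · simp only [_root_.smul_apply, smul_eq_mul]
      rw [lt_inv_mul_iff₀ hu0]; linarith
  -- shrink
  obtain ⟨c, hc0, hc1, hcf⟩ : ∃ c : ℝ, 0 < c ∧ c < 1 ∧ 1 < c * f z := by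
    refine ⟨(f z + 1) / (2 * f z), by positivity, ?_, ?_⟩
    · rw [div_lt_one (by linarith)]; linarith
    · rw [div_mul_eq_mul_div, lt_div_iff₀ (by linarith)]; nlinarith
  set e : EuclideanSpace ℝ (Fin n) := ‖z‖⁻¹ • z with he_def
  have hzn : 0 < ‖z‖ := norm_pos_iff.2 hz0
  have he : ‖e‖ = 1 := by
    rw [he_def, norm_smul, norm_inv, norm_norm, inv_mul_cancel₀ hzn.ne']
  have hze : ‖z‖ • e = z := by
    rw [he_def, smul_smul, mul_inv_cancel₀ hzn.ne', one_smul]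
  clear_value e
  set ρ : ℝ := c * ‖z‖ with hρ
  have hρ0 : 0 < ρ := by positivity
  set p : ℝ := ρ * f e with hp
  have hp1 : 1 < p := by
    have : p = c * f z := by
      have hz2 : f z = ‖z‖ * f e := by
        conv_lhs => rw [← hze]
        rw [map_smul, smul_eq_mul]
      rw [hp, hρ, hz2]; ring
    rw [this]; exact hcf
  -- small ball in K
  obtain ⟨d, hd0, hdK⟩ : ∃ d > 0, closedBall (0 : EuclideanSpace ℝ (Fin n)) d ⊆ K := by
    obtain ⟨d, hd, h⟩ := Metric.nhds_basis_closedBall.mem_iff.1 (mem_interior_iff_mem_nhds.1 hKint)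
    exact ⟨d, hd, h⟩
  have hK0 : (0 : EuclideanSpace ℝ (Fin n)) ∈ K := interior_subset hKint
  have hsegK : ∀ a : ℝ, |a| ≤ 1 → a • z ∈ K := by
    intro a ha
    have hnz : -z ∈ K := by rw [hKsymm]; simpa using hzK
    have h := abs_le.1 ha
    have := hKconv hzK hnz (a := (1 + a) / 2) (b := (1 - a) / 2) (by linarith) (by linarith)
      (by ring)
    convert this using 1
    module
  set δ : ℝ := (1 - c) * d with hδ
  have hδ0 : 0 < δ := mul_pos (by linarith) hd0
  set A : ℝ := ∫ θ, (inner ℝ e θ) ^ 2 ∂(sphereProb n) with hA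
  have hA0 : 0 < A := moment_pos hn e he
  -- choice of ε
  obtain ⟨ε, hε0, hε⟩ : ∃ ε : ℝ, 0 < ε ∧
      2 * ε * p * ‖f‖ + (ε / δ) ^ 2 < A * (p ^ 2 - 1) := by
    have hpos : 0 < A * (p ^ 2 - 1) := mul_pos hA0 (by nlinarith)
    have hcont : Continuous fun ε : ℝ => 2 * ε * p * ‖f‖ + (ε / δ) ^ 2 := by fun_prop
    have hev : ∀ᶠ ε : ℝ in nhds 0, 2 * ε * p * ‖f‖ + (ε / δ) ^ 2 < A * (p ^ 2 - 1) := by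
      apply hcont.continuousAt.eventually_lt continuousAt_const
      simpa using hpos
    have hev' := (hev.filter_mono (nhdsWithin_le_nhds (s := Ioi 0))).and self_mem_nhdsWithin
    obtain ⟨ε, h1, h2⟩ := hev'.exists
    exact ⟨ε, h2, h1⟩
  let L := dEquiv e he ρ ε hρ0.ne' hε0.ne'
  let G := dEquiv e he ρ δ hρ0.ne' hδ0.ne'
  obtain ⟨U, ⟨H, rfl⟩, hUT, hmin⟩ := hu (L '' closedBall 0 1) (isEllipsoid_image L)
  have hGK : G '' closedBall 0 1 ⊆ K := by
    rintro _ ⟨v, hv, rfl⟩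
    have hv1 : ‖v‖ ≤ 1 := by simpa using hv
    show dMap e ρ δ v ∈ K
    rw [dMap_apply]
    have h1 : (inner ℝ e v : ℝ) • z ∈ K := hsegK _ <| by
      have := abs_real_inner_le_norm e v
      rw [he] at this; linarith
    have h2 : d • (v - (inner ℝ e v : ℝ) • e) ∈ K := hdK <| by
      rw [mem_closedBall_zero_iff, norm_smul, Real.norm_eq_abs, abs_of_pos hd0]
      have := norm_perp_le he v
      nlinarith
    have := hKconv h1 h2 hc0.le (by linarith : 0 ≤ 1 - c) (by ring)
    convert this using 1
    have hz3 : (inner ℝ e v : ℝ) • z = ((inner ℝ e v : ℝ) * ‖z‖) • e := by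
      rw [mul_smul, hze]
    rw [hz3, hρ, hδ]
    module
  have hM := hmin _ (isEllipsoid_image G) hGK
  rw [Mfun_image, Mfun_image, Real.sqrt_le_sqrt_iff (integral_nonneg fun θ => by positivity)] at hM
  -- upper bound
  have hup : ∫ θ, ‖G.symm (L θ)‖ ^ 2 ∂(sphereProb n) ≤ A + (ε / δ) ^ 2 := by
    have : A + (ε / δ) ^ 2 = ∫ θ, ((inner ℝ e θ) ^ 2 + (ε / δ) ^ 2) ∂(sphereProb n) := by
      rw [integral_add (sphereProb_integrable hn (by fun_prop)) (integrable_const _)]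
      simp [hA]
    rw [this]
    refine integral_mono_ae (sphereProb_integrable hn
      (((continuous_equiv G.symm).comp (continuous_equiv L)).norm.pow 2))
      (sphereProb_integrable hn (by fun_prop)) ?_
    filter_upwards [sphereProb_ae] with θ hθ
    have h1 : G.symm (L θ) = dMap e ρ⁻¹ δ⁻¹ (dMap e ρ ε θ) := rfl
    rw [h1, dMap_comp he, inv_mul_cancel₀ hρ0.ne', dMap_apply, norm_perp_sq he, hθ,
      div_eq_inv_mul]
    nlinarith [mul_nonneg (sq_nonneg (δ⁻¹ * ε)) (sq_nonneg (inner ℝ e θ : ℝ))]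
  -- lower bound
  have hlow : p ^ 2 * A - 2 * ε * p * ‖f‖ ≤ ∫ θ, ‖H.symm (L θ)‖ ^ 2 ∂(sphereProb n) := by
    have : p ^ 2 * A - 2 * ε * p * ‖f‖
        = ∫ θ, (p ^ 2 * (inner ℝ e θ) ^ 2 - 2 * ε * p * ‖f‖) ∂(sphereProb n) := by
      rw [integral_sub (sphereProb_integrable hn (by fun_prop)) (integrable_const _),
        integral_const_mul]
      simp [hA]
    rw [this]
    refine integral_mono_ae (sphereProb_integrable hn (by fun_prop))
      (sphereProb_integrable hn
      (((continuous_equiv H.symm).comp (continuous_equiv L)).norm.pow 2)) ?_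
    filter_upwards [sphereProb_ae] with θ hθ
    have hfH : ∀ v, |f (H v)| ≤ ‖v‖ := by
      intro v
      rcases eq_or_ne v 0 with rfl | hv
      · simp
      · have hvn : 0 < ‖v‖ := norm_pos_iff.2 hv
        have := hfT1 (H (‖v‖⁻¹ • v)) (hUT ⟨_, by simp [norm_smul, hvn.ne'], rfl⟩)
        rw [map_smul, map_smul, smul_eq_mul, abs_mul, abs_inv, abs_norm,
          inv_mul_le_iff₀ hvn] at this
        linarith
    have h1 := hfH (H.symm (L θ))
    rw [LinearEquiv.apply_symm_apply] at h1
    have h2 : f (L θ) = p * inner ℝ e θ + ε * f (θ - (inner ℝ e θ : ℝ) • e) := by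
      have : L θ = dMap e ρ ε θ := rfl
      rw [this, dMap_apply, map_add, map_smul, map_smul (f) ε, hp]
      simp only [smul_eq_mul]; ring
    have h3 : (f (L θ)) ^ 2 ≤ ‖H.symm (L θ)‖ ^ 2 := by
      rw [← sq_abs]; gcongr
    have h4 : |f (θ - (inner ℝ e θ : ℝ) • e)| ≤ ‖f‖ := by
      have h5 := f.le_opNorm (θ - (inner ℝ e θ : ℝ) • e)
      have h6 := norm_perp_le he θ
      rw [hθ] at h6
      rw [Real.norm_eq_abs] at h5
      nlinarith [norm_nonneg f]
    have h7 : |(inner ℝ e θ : ℝ)| ≤ 1 := by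
      have := abs_real_inner_le_norm e θ
      rw [he, hθ] at this; linarith
    refine le_trans ?_ h3
    rw [h2]
    exact final_ineq hε0.le (by linarith) h7 h4
  linarith

end Helpers

/-- If `K, T` are compact symmetric convex bodies and `u_K = u_T`, where `u_K(E)` is the
unique ellipsoid contained in `K` minimizing `M_E`, then `K = T`. -/
theorem eq_of_uMap_eq
    (n : ℕ) (K T : Set (EuclideanSpace ℝ (Fin n)))
    (hKconv : Convex ℝ K) (hKcomp : IsCompact K) (hKsymm : K = -K)
    (hKint : (0 : EuclideanSpace ℝ (Fin n)) ∈ interior K)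
    (hTconv : Convex ℝ T) (hTcomp : IsCompact T) (hTsymm : T = -T)
    (hTint : (0 : EuclideanSpace ℝ (Fin n)) ∈ interior T)
    (uK uT : Set (EuclideanSpace ℝ (Fin n)) → Set (EuclideanSpace ℝ (Fin n)))
    (huK : ∀ E, IsEllipsoid E →
      IsEllipsoid (uK E) ∧ uK E ⊆ K ∧
      (∀ F, IsEllipsoid F → F ⊆ K → Mfun E (uK E) ≤ Mfun E F) ∧
      (∀ F, IsEllipsoid F → F ⊆ K → Mfun E F = Mfun E (uK E) → F = uK E))
    (huT : ∀ E, IsEllipsoid E →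
      IsEllipsoid (uT E) ∧ uT E ⊆ T ∧
      (∀ F, IsEllipsoid F → F ⊆ T → Mfun E (uT E) ≤ Mfun E F) ∧
      (∀ F, IsEllipsoid F → F ⊆ T → Mfun E F = Mfun E (uT E) → F = uT E))
    (h : uK = uT) :
    K = T := by
  subst h
  refine Set.Subset.antisymm ?_ ?_
  · exact key_subset K T hKconv hKsymm hKint hTconv hTcomp.isClosed hTsymm
      (interior_subset hTint) (fun E hE => ⟨uK E, (huK E hE).1, (huT E hE).2.1,
        (huK E hE).2.2.1⟩)
  · exact key_subset T K hTconv hTsymm hTint hKconv hKcomp.isClosed hKsymm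
      (interior_subset hKint) (fun E hE => ⟨uK E, (huK E hE).1, (huK E hE).2.1,
        (huT E hE).2.2.1⟩)

end
end
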